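/- Let 1 → ℤ/2ℤ × ℤ/2ℤ → G → Q → 1 be an exact sequence of groups, and assume that Q contains a normal subgroup of finite index N that is isomorphic to ℤ². Then G contains a normal subgroup of index exactly 144N that is abelian and generated by at most 4 elements. -/

import Mathlib

theorem Equiv.Perm.klein_pow_six_of_fixes_zero
    (σ : Equiv.Perm (ZMod 2 × ZMod 2)) (h : σ 0 = 0) : σ ^ 6 = 1 := by
  revert σ
  decide

theorem MulAut.klein_pow_six {K : Type*} [Group K]
    (e : K ≃* Multiplicative (ZMod 2 × ZMod 2)) (f : MulAut K) : f ^ 6 = 1 := by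
  let E : K ≃ ZMod 2 × ZMod 2 := e.toEquiv.trans Multiplicative.toAdd
  have hE : E 1 = 0 := by simp [E]
  have hE' : E.symm 0 = 1 := by rw [← hE, E.symm_apply_apply]
  have h := Equiv.Perm.klein_pow_six_of_fixes_zero (E.permCongrHom (MulAut.toPerm K f))
    (by change E (f (E.symm 0)) = 0; rw [hE', map_one, hE])
  rw [← map_pow, ← map_pow, MulEquiv.map_eq_one_iff] at h
  ext x
  exact congrArg (fun s : Equiv.Perm K => s x) h

/-- A sixth power centralizes every normal Klein four-subgroup. -/
theorem commute_pow_six_of_klein {G : Type*} [Group G] {K : Subgroup G} [K.Normal]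
    (e : K ≃* Multiplicative (ZMod 2 × ZMod 2)) (p : G) {k : G} (hk : k ∈ K) :
    Commute (p ^ 6) k := by
  have h : MulAut.conjNormal (p ^ 6) (⟨k, hk⟩ : K) = ⟨k, hk⟩ := by
    rw [map_pow, MulAut.klein_pow_six e, MulAut.one_apply]
  have h' := congrArg Subtype.val h
  rw [MulAut.conjNormal_apply] at h'
  exact mul_inv_eq_iff_eq_mul.mp h'

/-- If `u` and `v` commute up to a `c` of exponent two commuting with `u`,
then `u ^ 2` commutes with `v`. -/
theorem commute_sq_of_mul_eq {G : Type*} [Group G] {u v c : G} (huv : u * v = c * (v * u))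
    (hu : Commute u c) (hc : c * c = 1) : Commute (u ^ 2) v := by
  change u ^ 2 * v = v * u ^ 2
  calc u ^ 2 * v = u * (u * v) := by rw [sq, mul_assoc]
    _ = (u * c) * (v * u) := by rw [huv, mul_assoc]
    _ = c * (u * v) * u := by rw [hu.eq]; simp only [mul_assoc]
    _ = (c * c) * (v * u ^ 2) := by rw [huv, sq]; simp only [mul_assoc]
    _ = v * u ^ 2 := by rw [hc, one_mul]

theorem klein_mul_self {K : Type*} [Group K]
    (e : K ≃* Multiplicative (ZMod 2 × ZMod 2)) (k : K) : k * k = 1 := by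
  apply e.injective
  rw [map_mul, map_one]
  exact (by decide : ∀ v : ZMod 2 × ZMod 2, v + v = 0) (e k).toAdd

theorem klein_mul_comm {K : Type*} [Group K]
    (e : K ≃* Multiplicative (ZMod 2 × ZMod 2)) (k l : K) : k * l = l * k := by
  apply e.injective
  rw [map_mul, map_mul, mul_comm]

theorem klein_exists_pow_mul_pow {K : Type*} [Group K]
    (e : K ≃* Multiplicative (ZMod 2 × ZMod 2)) :
    ∃ k l : K, ∀ x : K, ∃ m n : ℕ, x = k ^ m * l ^ n := by
  refine ⟨e.symm (.ofAdd (1, 0)), e.symm (.ofAdd (0, 1)), fun x =>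
    ⟨(e x).toAdd.1.val, (e x).toAdd.2.val, e.injective ?_⟩⟩
  rw [map_mul, map_pow, map_pow, e.apply_symm_apply, e.apply_symm_apply]
  exact (by decide : ∀ v : ZMod 2 × ZMod 2, v = v.1.val • (1, 0) + v.2.val • (0, 1)) (e x).toAdd

theorem exists_zpow_mul_zpow_of_mulEquiv_int_prod_int {A : Type*} [Group A]
    (e : A ≃* Multiplicative (ℤ × ℤ)) :
    ∃ a b : A, ∀ x : A, ∃ m n : ℤ, x = a ^ m * b ^ n := by
  refine ⟨e.symm (.ofAdd (1, 0)), e.symm (.ofAdd (0, 1)), fun x =>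
    ⟨(e x).toAdd.1, (e x).toAdd.2, e.injective ?_⟩⟩
  rw [map_mul, map_zpow, map_zpow, e.apply_symm_apply, e.apply_symm_apply]
  change (e x).toAdd = (e x).toAdd.1 • ((1, 0) : ℤ × ℤ) + (e x).toAdd.2 • ((0, 1) : ℤ × ℤ)
  ext <;> simp

/-- The `n`-th powers in a group isomorphic to `ℤ²` form a subgroup of index `n * n`. -/
theorem exists_subgroup_pow_index {A : Type*} [Group A]
    (e : A ≃* Multiplicative (ℤ × ℤ)) (n : ℕ) :
    ∃ B : Subgroup A, (∀ x, x ∈ B ↔ ∃ a, x = a ^ n) ∧ B.index = n * n := by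
  let g : ℤ × ℤ →+ ZMod n × ZMod n :=
    (Int.castAddHom (ZMod n)).prodMap (Int.castAddHom (ZMod n))
  have hg : Function.Surjective g :=
    Function.Surjective.prodMap ZMod.intCast_surjective ZMod.intCast_surjective
  let f : A →* Multiplicative (ZMod n × ZMod n) := (AddMonoidHom.toMultiplicative g).comp e
  have hf : Function.Surjective f := hg.comp e.surjective
  refine ⟨f.ker, fun x => ⟨fun hx => ?_, ?_⟩, ?_⟩
  · have hx' : g (e x).toAdd = 0 := hx
    have h1 : (((e x).toAdd.1 : ℤ) : ZMod n) = 0 := congrArg Prod.fst hx'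
    have h2 : (((e x).toAdd.2 : ℤ) : ZMod n) = 0 := congrArg Prod.snd hx'
    rw [ZMod.intCast_zmod_eq_zero_iff_dvd] at h1 h2
    obtain ⟨i, hi⟩ := h1
    obtain ⟨j, hj⟩ := h2
    refine ⟨e.symm (.ofAdd (i, j)), e.injective ?_⟩
    rw [map_pow, e.apply_symm_apply]
    change (e x).toAdd = n • ((i, j) : ℤ × ℤ)
    ext <;> simp [hi, hj]
  · rintro ⟨a, rfl⟩
    rw [MonoidHom.mem_ker, map_pow]
    change n • (f a).toAdd = 0
    ext <;> simp
  · rw [Subgroup.index_ker, MonoidHom.range_eq_top.mpr hf, Nat.card_congr Subgroup.topEquiv.toEquiv,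
      Nat.card_congr Multiplicative.toAdd, Nat.card_prod, Nat.card_zmod]

/-- Let `1 → ℤ/2ℤ × ℤ/2ℤ → G → Q → 1` be an exact sequence of groups, and assume that
`Q` contains a normal subgroup of finite index `N` isomorphic to `ℤ²`. Then `G` contains
a normal subgroup of index exactly `144N` that is abelian and generated by at most
`4` elements. -/
theorem normal_abelian_rank_four_of_extension_klein_by_virtually_Z2
    {G Q : Type*} [Group G] [Group Q]
    (K : Subgroup G) [K.Normal]
    (hK : Nonempty (K ≃* Multiplicative (ZMod 2 × ZMod 2)))
    (hGQ : Nonempty ((G ⧸ K) ≃* Q))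
    (N : ℕ) (hN : N ≠ 0) (A : Subgroup Q) (hA : A.Normal) (hAidx : A.index = N)
    (hAiso : Nonempty (A ≃* Multiplicative (ℤ × ℤ))) :
    ∃ H : Subgroup G, H.Normal ∧ H.index = 144 * N ∧
      (∀ x ∈ H, ∀ y ∈ H, x * y = y * x) ∧
      ∃ S : Finset G, S.card ≤ 4 ∧ Subgroup.closure (S : Set G) = H := by
  classical
  obtain ⟨eK⟩ := hK
  obtain ⟨eQ⟩ := hGQ
  obtain ⟨eA⟩ := hAiso
  have hKcomm : ∀ k ∈ K, ∀ l ∈ K, Commute k l := fun k hk l hl =>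
    congrArg Subtype.val (klein_mul_comm eK ⟨k, hk⟩ ⟨l, hl⟩)
  let φ : G →* Q := eQ.toMonoidHom.comp (QuotientGroup.mk' K)
  have hφ : Function.Surjective φ := eQ.surjective.comp (QuotientGroup.mk'_surjective K)
  have hker : ∀ x, φ x = 1 → x ∈ K := fun x hx =>
    (QuotientGroup.eq_one_iff x).mp ((MulEquiv.map_eq_one_iff eQ).mp hx)
  have hker' : ∀ x ∈ K, φ x = 1 := fun x hx =>
    (MulEquiv.map_eq_one_iff eQ).mpr ((QuotientGroup.eq_one_iff x).mpr hx)
  have hfiber : ∀ x y, φ x = φ y → ∃ k ∈ K, x = y * k := fun x y h =>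
    ⟨y⁻¹ * x, hker _ (by rw [map_mul, map_inv, h, inv_mul_cancel]), by group⟩
  obtain ⟨B, hB, hBidx⟩ := exists_subgroup_pow_index eA 12
  have hBmem : ∀ q, q ∈ B.map A.subtype ↔ ∃ a ∈ A, q = a ^ 12 := by
    intro q
    constructor
    · rintro ⟨b, hb, rfl⟩
      obtain ⟨a, rfl⟩ := (hB b).mp hb
      exact ⟨a, a.2, rfl⟩
    · rintro ⟨a, ha, rfl⟩
      exact ⟨⟨a, ha⟩ ^ 12, (hB _).mpr ⟨_, rfl⟩, rfl⟩
  have hBnormal : (B.map A.subtype).Normal := by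
    refine ⟨fun q hq g => ?_⟩
    obtain ⟨a, ha, rfl⟩ := (hBmem q).mp hq
    exact (hBmem _).mpr ⟨g * a * g⁻¹, hA.conj_mem a ha g, conj_pow.symm⟩
  have hHmem : ∀ x ∈ (B.map A.subtype).comap φ, ∃ p, φ p ∈ A ∧ ∃ k ∈ K, x = p ^ 12 * k := by
    intro x hx
    obtain ⟨a, ha, hxa⟩ := (hBmem _).mp hx
    obtain ⟨p, rfl⟩ := hφ a
    exact ⟨p, ha, hfiber _ _ (by rw [hxa, map_pow])⟩
  refine ⟨(B.map A.subtype).comap φ, hBnormal.comap φ, ?_, ?_, ?_⟩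
  · rw [Subgroup.index_comap_of_surjective _ hφ, Subgroup.index_map_subtype, hBidx, hAidx]
  · intro x hx y hy
    obtain ⟨p, hp, k, hk, rfl⟩ := hHmem x hx
    obtain ⟨q, hq, l, hl, rfl⟩ := hHmem y hy
    have hcentral : ∀ r : G, ∀ m ∈ K, Commute (r ^ 12) m := fun r m hm => by
      rw [show r ^ 12 = (r ^ 6) ^ 2 by rw [← pow_mul]]
      exact (commute_pow_six_of_klein eK r hm).pow_left 2
    have hcomm : Commute (φ p) (φ q) :=
      congrArg Subtype.val (show (⟨φ p, hp⟩ : A) * ⟨φ q, hq⟩ = ⟨φ q, hq⟩ * ⟨φ p, hp⟩ from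
        eA.injective (by rw [map_mul, map_mul, mul_comm]))
    have hc : p ^ 6 * q ^ 6 * (q ^ 6 * p ^ 6)⁻¹ ∈ K := hker _ <| by
      simp only [map_mul, map_inv, map_pow]
      rw [(hcomm.pow_pow 6 6).eq, mul_inv_cancel]
    have hpq : Commute (p ^ 12) (q ^ 12) := by
      rw [show p ^ 12 = (p ^ 6) ^ 2 by rw [← pow_mul], show q ^ 12 = (q ^ 6) ^ 2 by rw [← pow_mul]]
      exact (commute_sq_of_mul_eq (inv_mul_cancel_right _ _).symm
        (commute_pow_six_of_klein eK p hc)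
        (congrArg Subtype.val (klein_mul_self eK ⟨_, hc⟩))).pow_right 2
    exact ((hpq.mul_right (hcentral p l hl)).mul_left
      ((hcentral q k hk).symm.mul_right (hKcomm k hk l hl))).eq
  · obtain ⟨a, b, hab⟩ := exists_zpow_mul_zpow_of_mulEquiv_int_prod_int eA
    obtain ⟨k, l, hkl⟩ := klein_exists_pow_mul_pow eK
    obtain ⟨p, hp⟩ := hφ a
    obtain ⟨q, hq⟩ := hφ b
    refine ⟨{p ^ 12, q ^ 12, (k : G), (l : G)}, Finset.card_le_four, le_antisymm ?_ ?_⟩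
    · rw [Subgroup.closure_le]
      intro x hx
      simp only [Finset.coe_insert, Finset.coe_singleton, Set.mem_insert_iff,
        Set.mem_singleton_iff] at hx
      refine (hBmem _).mpr ?_
      rcases hx with rfl | rfl | rfl | rfl
      · exact ⟨a, a.2, by rw [map_pow, hp]⟩
      · exact ⟨b, b.2, by rw [map_pow, hq]⟩
      · exact ⟨1, A.one_mem, by rw [hker' _ k.2, one_pow]⟩
      · exact ⟨1, A.one_mem, by rw [hker' _ l.2, one_pow]⟩
    · intro x hx
      obtain ⟨c, hc, hxc⟩ := (hBmem _).mp hx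
      obtain ⟨m, n, hmn⟩ := hab ⟨c, hc⟩
      have hab' : Commute a b := eA.injective (by rw [map_mul, map_mul, mul_comm])
      have hpow : (⟨c, hc⟩ : A) ^ 12 = (a ^ 12) ^ m * (b ^ 12) ^ n := by
        rw [hmn, (hab'.zpow_zpow m n).mul_pow]
        simp only [← zpow_natCast, ← zpow_mul, mul_comm]
      obtain ⟨z, hz, rfl⟩ := hfiber x ((p ^ 12) ^ m * (q ^ 12) ^ n) (by
        rw [hxc, map_mul, map_zpow, map_zpow, map_pow, map_pow, hp, hq]
        exact congrArg Subtype.val hpow)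
      obtain ⟨i, j, hij⟩ := hkl ⟨z, hz⟩
      have hz' : z = (k : G) ^ i * (l : G) ^ j := congrArg Subtype.val hij
      rw [hz']
      refine mul_mem (mul_mem (zpow_mem ?_ _) (zpow_mem ?_ _))
        (mul_mem (pow_mem ?_ _) (pow_mem ?_ _)) <;>
      exact Subgroup.subset_closure (by simp)
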